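/- Let M₁,…,M_{ℓ+1} be natural numbers and let E be a finite set of pairs (k, x) where 1 ≤ k ≤ ℓ and x = (i_{k+1},…,i_{ℓ+1}) satisfies 0 ≤ i_r ≤ M_r for k+1 ≤ r ≤ ℓ and |i_{ℓ+1}| ≤ M_{ℓ+1}; write B_{k,x} = {γ ∈ Γ : γ(k) > M_k and γ(r) = i_r for all k+1 ≤ r ≤ ℓ+1} and A₂ = {γ ∈ Γ : γ(ℓ+1) < −M_{ℓ+1}}. Let Γ⁺ = A₂ ∪ ⋃_{(k,x)∈E} B_{k,x}, let P be the orthogonal projection of H onto the closed span of {e_γ : γ ∈ Γ⁺}, and let U be the unitary with U e_γ = e_{γ+ε_{ℓ+1}} if γ(1)=…=γ(ℓ)=0 and U e_γ = e_γ otherwise. Then the compression T : ran P → ran P, T x = P(U x), is surjective and its kernel is the one-dimensional span of e_{(0,…,0,−M_{ℓ+1}−1)}. In particular T is Fredholm of index +1. -/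

import Mathlib

open scoped BigOperators InnerProductSpace

noncomputable section

/-- The index set `Γ = ℕ^ℓ × ℤ`. -/
abbrev Gamma (ℓ : ℕ) : Type := (Fin ℓ → ℕ) × ℤ

/-- The Hilbert space `H = ℓ²(Γ)`. -/
abbrev Hsp (ℓ : ℕ) := lp (fun _ : Gamma ℓ => ℂ) 2

/-- The standard orthonormal basis vector `e_γ`. -/
def e (ℓ : ℕ) (γ : Gamma ℓ) : Hsp ℓ := lp.single 2 γ 1

/-- `ε_k ∈ Γ`: the element whose `k`-th coordinate is `1` and all other coordinates are `0`
(`k` is zero-indexed: `k : Fin (ℓ+1)` corresponds to the coordinate `k+1` of the paper). -/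
def eps (ℓ : ℕ) (k : Fin (ℓ+1)) : Gamma ℓ :=
  if h : (k : ℕ) < ℓ then (Pi.single ⟨(k : ℕ), h⟩ 1, 0) else (0, 1)

/-- The `k`-th coordinate of `γ ∈ Γ`, viewed in `ℤ` (zero-indexed). -/
def coord {ℓ : ℕ} (γ : Gamma ℓ) (k : Fin (ℓ+1)) : ℤ :=
  if h : (k : ℕ) < ℓ then (γ.1 ⟨(k : ℕ), h⟩ : ℤ) else γ.2

/-- `γ(1) + … + γ(k−1)` (sum of the coordinates strictly before position `k`). -/
def sumBelow {ℓ : ℕ} (k : Fin (ℓ+1)) (γ : Gamma ℓ) : ℕ :=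
  ∑ j ∈ Finset.univ.filter (fun j : Fin ℓ => (j : ℕ) < (k : ℕ)), γ.1 j

/-- The growth condition `|d(γ+ε_k) − d(γ)| ≤ c·q^{−(γ(1)+…+γ(k−1))}` for all `γ` and `k`. -/
def GrowthCondition (ℓ : ℕ) (q c : ℝ) (d : Gamma ℓ → ℝ) : Prop :=
  ∀ (k : Fin (ℓ+1)) (γ : Gamma ℓ),
    |d (γ + eps ℓ k) - d γ| ≤ c * (q ^ sumBelow k γ)⁻¹

/-- The set `B_{k,x} = {γ : γ(k) > M_k, γ(r) = x_r for r > k}` (zero-indexed `k`). -/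
def Bset (ℓ : ℕ) (M : Fin (ℓ+1) → ℕ) (k : Fin ℓ) (x : Fin (ℓ+1) → ℤ) : Set (Gamma ℓ) :=
  {γ : Gamma ℓ | (M k.castSucc : ℤ) < (γ.1 k : ℤ) ∧
    ∀ r : Fin (ℓ+1), (k : ℕ) < (r : ℕ) → coord γ r = x r}

/-- `A₁ = {γ : γ(ℓ+1) > M_{ℓ+1}}`. -/
def A1set (ℓ : ℕ) (M : Fin (ℓ+1) → ℕ) : Set (Gamma ℓ) :=
  {γ : Gamma ℓ | (M (Fin.last ℓ) : ℤ) < γ.2}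

/-- `A₂ = {γ : γ(ℓ+1) < −M_{ℓ+1}}`. -/
def A2set (ℓ : ℕ) (M : Fin (ℓ+1) → ℕ) : Set (Gamma ℓ) :=
  {γ : Gamma ℓ | γ.2 < -(M (Fin.last ℓ) : ℤ)}

/-- The admissibility condition on the finite index set `E`:
each `(k, x) ∈ E` satisfies `0 ≤ x_r ≤ M_r` for `k < r ≤ ℓ` and `|x_{ℓ+1}| ≤ M_{ℓ+1}`. -/
def Eadm (ℓ : ℕ) (M : Fin (ℓ+1) → ℕ) (E : Finset (Fin ℓ × (Fin (ℓ+1) → ℤ))) : Prop :=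
  ∀ p ∈ E, (∀ r : Fin ℓ, (p.1 : ℕ) < (r : ℕ) →
      0 ≤ p.2 r.castSucc ∧ p.2 r.castSucc ≤ (M r.castSucc : ℤ)) ∧
    |p.2 (Fin.last ℓ)| ≤ (M (Fin.last ℓ) : ℤ)

lemma e_apply (ℓ : ℕ) (γ δ : Gamma ℓ) : e ℓ γ δ = if γ = δ then 1 else 0 := by
  unfold e
  rw [lp.single_apply]
  by_cases h : γ = δ
  · subst h; simp
  · simp [h, Ne.symm h]

lemma inner_e_left (ℓ : ℕ) (γ : Gamma ℓ) (f : Hsp ℓ) : inner ℂ (e ℓ γ) f = f γ := by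
  unfold e
  rw [lp.inner_single_left]
  simp

lemma hasSum_apply_smul_apply_e (ℓ : ℕ) (A : Hsp ℓ →L[ℂ] Hsp ℓ) (x : Hsp ℓ) (δ : Gamma ℓ) :
    HasSum (fun γ => x γ * A (e ℓ γ) δ) (A x δ) := by
  have h := lp.hasSum_single (p := 2) (by norm_num) x
  have h' := ((innerSL ℂ (e ℓ δ)).comp A).hasSum h
  simp only [ContinuousLinearMap.comp_apply, innerSL_apply_apply, inner_e_left] at h'
  refine h'.congr_fun ?_
  intro γ
  have : lp.single 2 γ (x γ) = x γ • e ℓ γ := by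
    unfold e
    rw [← lp.single_smul]; simp
  rw [this]; simp

lemma apply_eq_of_apply_e_eq_ite (ℓ : ℕ) (A : Hsp ℓ →L[ℂ] Hsp ℓ) (δ δ' : Gamma ℓ)
    (h : ∀ γ, A (e ℓ γ) δ = if γ = δ' then 1 else 0) (x : Hsp ℓ) : A x δ = x δ' := by
  refine (hasSum_apply_smul_apply_e ℓ A x δ).unique ?_
  convert hasSum_ite_eq δ' (x δ') using 2 with γ
  rw [h]
  split_ifs with hγ <;> simp [hγ]

lemma apply_eq_zero_of_apply_e_eq_zero (ℓ : ℕ) (A : Hsp ℓ →L[ℂ] Hsp ℓ) (δ : Gamma ℓ)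
    (h : ∀ γ, A (e ℓ γ) δ = 0) (x : Hsp ℓ) : A x δ = 0 := by
  refine (hasSum_apply_smul_apply_e ℓ A x δ).unique ?_
  simp only [h, mul_zero]
  exact hasSum_zero

lemma coordinateProjection_apply (ℓ : ℕ) (G : Set (Gamma ℓ)) (P : Hsp ℓ →L[ℂ] Hsp ℓ)
    (hP1 : ∀ γ ∈ G, P (e ℓ γ) = e ℓ γ) (hP2 : ∀ γ ∉ G, P (e ℓ γ) = 0) (x : Hsp ℓ) :
    (∀ γ ∈ G, P x γ = x γ) ∧ ∀ γ ∉ G, P x γ = 0 := by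
  refine ⟨fun δ hδ => apply_eq_of_apply_e_eq_ite ℓ P δ δ (fun γ => ?_) x,
    fun δ hδ => apply_eq_zero_of_apply_e_eq_zero ℓ P δ (fun γ => ?_) x⟩
  · by_cases hγ : γ ∈ G
    · rw [hP1 γ hγ, e_apply]
    · rw [hP2 γ hγ, if_neg (by rintro rfl; exact hγ hδ)]; rfl
  · by_cases hγ : γ ∈ G
    · rw [hP1 γ hγ, e_apply, if_neg (by rintro rfl; exact hδ hγ)]
    · rw [hP2 γ hγ]; rfl

lemma eps_last (ℓ : ℕ) : eps ℓ (Fin.last ℓ) = (0, 1) := by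
  simp [eps]

lemma axisShift_apply (ℓ : ℕ) (U : Hsp ℓ →L[ℂ] Hsp ℓ)
    (hU1 : ∀ γ : Gamma ℓ, γ.1 = 0 → U (e ℓ γ) = e ℓ (γ + eps ℓ (Fin.last ℓ)))
    (hU2 : ∀ γ : Gamma ℓ, γ.1 ≠ 0 → U (e ℓ γ) = e ℓ γ) (x : Hsp ℓ) :
    (∀ n : ℤ, U x (0, n) = x (0, n - 1)) ∧ ∀ γ : Gamma ℓ, γ.1 ≠ 0 → U x γ = x γ := by
  refine ⟨fun n => apply_eq_of_apply_e_eq_ite ℓ U _ _ (fun γ => ?_) x,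
    fun δ hδ => apply_eq_of_apply_e_eq_ite ℓ U _ _ (fun γ => ?_) x⟩
  · by_cases hγ : γ.1 = 0
    · rw [hU1 γ hγ, e_apply, eps_last]
      refine if_congr ?_ rfl rfl
      simp [Prod.ext_iff, hγ, eq_sub_iff_add_eq]
    · rw [hU2 γ hγ, e_apply, if_neg (fun h => hγ (by rw [h])), if_neg (fun h => hγ (by rw [h]))]
  · by_cases hγ : γ.1 = 0
    · rw [hU1 γ hγ, e_apply, eps_last, if_neg (fun h => hδ (by rw [← h]; simp [hγ])),
        if_neg (by rintro rfl; exact hδ hγ)]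
    · rw [hU2 γ hγ, e_apply]

lemma axisShift_adjoint_apply (ℓ : ℕ) (U : Hsp ℓ →L[ℂ] Hsp ℓ)
    (hU1 : ∀ γ : Gamma ℓ, γ.1 = 0 → U (e ℓ γ) = e ℓ (γ + eps ℓ (Fin.last ℓ)))
    (hU2 : ∀ γ : Gamma ℓ, γ.1 ≠ 0 → U (e ℓ γ) = e ℓ γ) (y : Hsp ℓ) :
    (∀ n : ℤ, U.adjoint y (0, n) = y (0, n + 1)) ∧
      ∀ γ : Gamma ℓ, γ.1 ≠ 0 → U.adjoint y γ = y γ := by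
  constructor
  · intro n
    rw [← inner_e_left, ContinuousLinearMap.adjoint_inner_right, hU1 _ rfl, inner_e_left, eps_last]
    simp
  · intro γ hγ
    rw [← inner_e_left, ContinuousLinearMap.adjoint_inner_right, hU2 _ hγ, inner_e_left]

lemma axis_mem_iff (ℓ : ℕ) (M : Fin (ℓ+1) → ℕ) (E : Finset (Fin ℓ × (Fin (ℓ+1) → ℤ))) (n : ℤ) :
    ((0, n) : Gamma ℓ) ∈ A2set ℓ M ∪ ⋃ p ∈ E, Bset ℓ M p.1 p.2 ↔
      n < -(M (Fin.last ℓ) : ℤ) := by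
  constructor
  · rintro (h | h)
    · exact h
    · simp only [Set.mem_iUnion] at h
      obtain ⟨p, -, h, -⟩ := h
      simp at h
      omega
  · exact fun h => Or.inl h

/-- for `Γ⁺ = A₂ ∪ ⋃_{(k,x)∈E} B_{k,x}`, the compression `T = PUP` of the
unitary `U` to `ran P` is surjective and its kernel is the one-dimensional span of
`e_{(0,…,0,−M_{ℓ+1}−1)}`; in particular `T` is Fredholm of index `+1`. -/
theorem stmt11 (ℓ : ℕ) (hℓ : 1 ≤ ℓ) (M : Fin (ℓ+1) → ℕ)
    (E : Finset (Fin ℓ × (Fin (ℓ+1) → ℤ))) (hE : Eadm ℓ M E)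
    (U P : Hsp ℓ →L[ℂ] Hsp ℓ)
    (hU1 : ∀ γ : Gamma ℓ, γ.1 = 0 → U (e ℓ γ) = e ℓ (γ + eps ℓ (Fin.last ℓ)))
    (hU2 : ∀ γ : Gamma ℓ, γ.1 ≠ 0 → U (e ℓ γ) = e ℓ γ)
    (hP1 : ∀ γ ∈ A2set ℓ M ∪ ⋃ p ∈ E, Bset ℓ M p.1 p.2, P (e ℓ γ) = e ℓ γ)
    (hP2 : ∀ γ ∉ A2set ℓ M ∪ ⋃ p ∈ E, Bset ℓ M p.1 p.2, P (e ℓ γ) = 0) :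
    (∀ y : Hsp ℓ, P y = y → ∃ x : Hsp ℓ, P x = x ∧ P (U x) = y) ∧
    (∀ x : Hsp ℓ, P x = x →
      (P (U x) = 0 ↔ ∃ c : ℂ, x = c • e ℓ (0, -(M (Fin.last ℓ) : ℤ) - 1))) := by
  have hG := axis_mem_iff ℓ M E
  set G := A2set ℓ M ∪ ⋃ p ∈ E, Bset ℓ M p.1 p.2
  have hPx := coordinateProjection_apply ℓ G P hP1 hP2
  have hUx := axisShift_apply ℓ U hU1 hU2
  have hVx := axisShift_adjoint_apply ℓ U hU1 hU2
  have hran : ∀ y : Hsp ℓ, P y = y → ∀ γ ∉ G, y γ = 0 := by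
    intro y hy γ hγ
    rw [← hy]
    exact (hPx y).2 γ hγ
  constructor
  · intro y hy
    have hy0 := hran y hy
    refine ⟨U.adjoint y, ?_, ?_⟩
    · ext γ
      by_cases hγ : γ ∈ G
      · exact (hPx _).1 γ hγ
      rw [(hPx _).2 γ hγ]
      obtain ⟨a, n⟩ := γ
      by_cases ha : a = 0
      · subst ha
        rw [(hVx y).1, hy0]
        rw [hG] at hγ ⊢
        omega
      · rw [(hVx y).2 _ ha, hy0 _ hγ]
    · ext γ
      by_cases hγ : γ ∈ G
      · rw [(hPx _).1 γ hγ]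
        obtain ⟨a, n⟩ := γ
        by_cases ha : a = 0
        · subst ha
          rw [(hUx _).1, (hVx y).1, sub_add_cancel]
        · rw [(hUx _).2 _ ha, (hVx y).2 _ ha]
      · rw [(hPx _).2 γ hγ, hy0 γ hγ]
  · intro x hx
    have hx0 := hran x hx
    constructor
    · intro h
      refine ⟨x (0, -(M (Fin.last ℓ) : ℤ) - 1), ?_⟩
      have hUx0 : ∀ γ ∈ G, U x γ = 0 := by
        intro γ hγ
        rw [← (hPx _).1 γ hγ, h]; rfl
      ext γ
      rw [lp.coeFn_smul, Pi.smul_apply, e_apply]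
      split_ifs with hγ
      · simp [← hγ]
      · rw [smul_zero]
        by_cases hγG : γ ∈ G
        · obtain ⟨a, n⟩ := γ
          by_cases ha : a = 0
          · subst ha
            have hn : n ≠ -(M (Fin.last ℓ) : ℤ) - 1 := fun hn => hγ (by rw [hn])
            have := (hUx x).1 (n + 1)
            rw [add_sub_cancel_right] at this
            rw [← this, hUx0]
            rw [hG] at hγG ⊢
            omega
          · rw [← (hUx x).2 _ ha, hUx0 _ hγG]
        · exact hx0 γ hγG
    · rintro ⟨c, rfl⟩
      rw [map_smul, map_smul, hU1 _ rfl, eps_last, hP2, smul_zero]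
      simp only [Prod.mk_add_mk, add_zero]
      rw [hG]
      omega
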